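/- Let w and n be natural numbers with 1 ≤ w ≤ n, and define, by strong recursion on i, probability mass functions T_i on ℕ: T_i is the law of the experiment that draws j uniformly from {0, 1, ..., w+i−1}, outputs 1 if j < w, and otherwise outputs 1 + X where X is drawn from T_{j−w}. Then the expectation of T_{n−w} is at most 1 + ln(n/w) and the variance of T_{n−w} is at most ln(n/w). -/

import Mathlib

/-- `memT w hw i` : the law of the number of iterations of the external lookup loop of
MementoHash when the bucket first hit is the `(i+1)`-th most recently removed one:
draw `j` uniformly from `{0, …, w+i−1}`; output `1` if `j < w` (a working bucket is hit),
otherwise output `1 + X` where `X ∼ memT w hw (j − w)`. -/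
noncomputable def memT (w : ℕ) (hw : 0 < w) : ℕ → PMF ℕ
  | i =>
    haveI : Nonempty (Fin (w + i)) := ⟨⟨0, by omega⟩⟩
    (PMF.uniformOfFintype (Fin (w + i))).bind fun j =>
      if h : (j : ℕ) < w then PMF.pure 1
      else
        have hlt : (j : ℕ) - w < i := by have := j.isLt; omega
        (memT w hw ((j : ℕ) - w)).map (· + 1)
  termination_by i => i

noncomputable def memC (w : ℕ) (hw : 0 < w) (j : ℕ) : PMF ℕ :=
  if j < w then PMF.pure 1 else (memT w hw (j - w)).map (· + 1)

lemma memT_apply (w : ℕ) (hw : 0 < w) (i a : ℕ) :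
    ((w + i : ℕ) : ℝ) * (memT w hw i a).toReal
      = ∑ j ∈ Finset.range (w + i), (memC w hw j a).toReal := by
  have hne : ((w + i : ℕ) : ℝ) ≠ 0 := by
    have : w + i ≠ 0 := by omega
    exact_mod_cast this
  rw [memT]
  simp only [PMF.bind_apply, PMF.uniformOfFintype_apply, Fintype.card_fin, tsum_fintype]
  rw [← Finset.mul_sum, ENNReal.toReal_mul, ENNReal.toReal_inv, ENNReal.toReal_natCast,
    mul_inv_cancel_left₀ hne, ENNReal.toReal_sum (fun j _ => PMF.apply_ne_top _ _),
    Finset.sum_range]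
  refine Finset.sum_congr rfl fun j _ => ?_
  unfold memC
  split_ifs <;> rfl

lemma memC_add_zero (w : ℕ) (hw : 0 < w) (i : ℕ) : memC w hw (w + i) 0 = 0 := by
  simp [memC, PMF.map_apply]

lemma memC_add_succ (w : ℕ) (hw : 0 < w) (i a : ℕ) :
    memC w hw (w + i) (a + 1) = memT w hw i a := by
  simp [memC, PMF.map_apply]

lemma memT_rec (w : ℕ) (hw : 0 < w) (i a : ℕ) :
    ((w + i : ℕ) + 1 : ℝ) * (memT w hw (i + 1) a).toReal
      = ((w + i : ℕ) : ℝ) * (memT w hw i a).toReal + (memC w hw (w + i) a).toReal := by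
  have h := memT_apply w hw (i + 1) a
  rw [← add_assoc, Finset.sum_range_succ, ← memT_apply] at h
  push_cast at h ⊢
  exact h

lemma memT_zero (w : ℕ) (hw : 0 < w) (a : ℕ) :
    (memT w hw 0 a).toReal = if a = 1 then 1 else 0 := by
  have hne : (w : ℝ) ≠ 0 := by exact_mod_cast hw.ne'
  have h := memT_apply w hw 0 a
  rw [Finset.sum_congr rfl (g := fun _ => if a = 1 then (1 : ℝ) else 0)] at h
  · simp only [add_zero, Finset.sum_const, Finset.card_range, nsmul_eq_mul] at h
    exact mul_left_cancel₀ hne h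
  · intro j hj
    have : j < w := by simpa using hj
    simp only [memC, this, if_true, PMF.pure_apply]
    split_ifs <;> simp

lemma memT_step (w : ℕ) (hw : 0 < w) (i : ℕ) (f : ℕ → ℝ) (x y : ℝ)
    (hx : HasSum (fun a => f a * (memT w hw i a).toReal) x)
    (hy : HasSum (fun a => f (a + 1) * (memT w hw i a).toReal) y) :
    HasSum (fun a => f a * (memT w hw (i + 1) a).toReal)
      (x + (y - x) / ((w + i : ℕ) + 1 : ℝ)) := by
  have hne : ((w + i : ℕ) + 1 : ℝ) ≠ 0 := by positivity
  have h1 : HasSum (fun a => f a * (memC w hw (w + i) a).toReal) y := by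
    rw [← hasSum_nat_add_iff' 1]
    simpa [memC_add_zero, memC_add_succ] using hy
  have h2 := ((hx.mul_left ((w + i : ℕ) : ℝ)).add h1).div_const ((w + i : ℕ) + 1 : ℝ)
  convert h2 using 1
  · rfl
  · funext a
    rw [eq_div_iff hne]
    linear_combination f a * memT_rec w hw i a
  · field_simp
    ring

lemma memT_main (w : ℕ) (hw : 0 < w) (i : ℕ) : ∃ m s : ℝ,
    HasSum (fun a => (memT w hw i a).toReal) 1 ∧
    HasSum (fun a : ℕ => (a : ℝ) * (memT w hw i a).toReal) m ∧
    HasSum (fun a : ℕ => (a : ℝ) ^ 2 * (memT w hw i a).toReal) s ∧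
    m ≤ 1 + Real.log (((w + i : ℕ) : ℝ) / w) ∧
    s - m ^ 2 ≤ Real.log (((w + i : ℕ) : ℝ) / w) := by
  have hw0 : (0 : ℝ) < w := by exact_mod_cast hw
  induction i with
  | zero =>
    refine ⟨1, 1, ?_, ?_, ?_, ?_, ?_⟩
    · simpa [memT_zero] using hasSum_ite_eq (1 : ℕ) (1 : ℝ)
    · convert hasSum_ite_eq (1 : ℕ) (1 : ℝ) using 2 with a
      rw [memT_zero]; split_ifs with h <;> simp [h]
    · convert hasSum_ite_eq (1 : ℕ) (1 : ℝ) using 2 with a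
      rw [memT_zero]; split_ifs with h <;> simp [h]
    · simp [hw0.ne']
    · simp [hw0.ne']
  | succ i ih =>
    obtain ⟨m, s, h0, h1, h2, hm, hs⟩ := ih
    have g0 := memT_step w hw i (fun _ => 1) 1 1 (by simpa using h0) (by simpa using h0)
    have g1 := memT_step w hw i (fun a => (a : ℝ)) m (m + 1) h1 (by
      convert h1.add h0 using 2 with a
      push_cast; ring)
    have g2 := memT_step w hw i (fun a => (a : ℝ) ^ 2) s (s + 2 * m + 1) h2 (by
      convert (h2.add (h1.mul_left 2)).add h0 using 2 with a
      · push_cast; ring)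
    set N : ℝ := ((w + i : ℕ) : ℝ) with hN
    have hN0 : 0 < N := by rw [hN]; exact_mod_cast (by omega : 0 < w + i)
    have hcast : ((w + (i + 1) : ℕ) : ℝ) = N + 1 := by rw [hN]; push_cast; ring
    have hlog : Real.log (N / w) + 1 / (N + 1) ≤ Real.log ((N + 1) / w) := by
      rw [Real.log_div hN0.ne' hw0.ne', Real.log_div (by positivity) hw0.ne']
      have := Real.log_le_sub_one_of_pos (show 0 < N / (N + 1) by positivity)
      rw [Real.log_div hN0.ne' (by positivity)] at this
      have e : N / (N + 1) - 1 = - (1 / (N + 1)) := by field_simp; ring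
      linarith
    refine ⟨_, _, by simpa using g0, g1, g2, ?_, ?_⟩
    · rw [hcast]
      have : (m + 1 - m) / (N + 1) = 1 / (N + 1) := by ring
      linarith
    · rw [hcast]
      have e : s + (s + 2 * m + 1 - s) / (N + 1) - (m + (m + 1 - m) / (N + 1)) ^ 2
        = (s - m ^ 2) + 1 / (N + 1) - (1 / (N + 1)) ^ 2 := by ring
      rw [e]
      have := sq_nonneg (1 / (N + 1))
      linarith

/-- For `1 ≤ w ≤ n`, the expectation of `memT w hw (n−w)` is at most `1 + ln(n/w)`
and its variance is at most `ln(n/w)`. -/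
theorem stmt_10 (w n : ℕ) (hw : 1 ≤ w) (hn : w ≤ n) :
    (∑' a : ℕ, (a : ℝ) * ((memT w hw (n - w)) a).toReal
        ≤ 1 + Real.log ((n : ℝ) / (w : ℝ))) ∧
      (∑' a : ℕ, (a : ℝ) ^ 2 * ((memT w hw (n - w)) a).toReal)
          - (∑' a : ℕ, (a : ℝ) * ((memT w hw (n - w)) a).toReal) ^ 2
        ≤ Real.log ((n : ℝ) / (w : ℝ)) := by
  obtain ⟨m, s, -, h1, h2, hm, hs⟩ := memT_main w hw (n - w)
  rw [Nat.add_sub_cancel' hn] at hm hs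
  rw [h1.tsum_eq, h2.tsum_eq]
  exact ⟨hm, hs⟩
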